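/- arXiv:2110.05426 — 2 statements merged into one kernel-verified Lean document; each statement's English description precedes it below -/
import Mathlib

section
/- Let p be a prime, let n ≥ 1 and d ≥ 1 be integers, let Ψ be a finite set of cardinality d, and let M be a commutative topological group. Let T = ℤ_p^× × ∏_{τ∈Ψ} (ℤ_p^×)^{2n} (coordinates y_{τ,1}, …, y_{τ,2n} in each factor) and let T_0 ≤ T be the subgroup of elements (x, y) with y_{τ,i} = y_{τ,2n+1−i} for all τ ∈ Ψ and all 1 ≤ i ≤ 2n. For 1 ≤ i ≤ n and τ ∈ Ψ define the continuous homomorphism λ_{i,τ} : T → ℤ_p^× by λ_{i,τ}(x, y) = (∏_{k=1}^{i} y_{τ,k})·(∏_{k=2n+1−i}^{2n} y_{τ,k})^{-1}. Then for every continuous homomorphism λ : T → M that is trivial on T_0, there exist unique continuous homomorphisms ξ_{i,τ} : ℤ_p^× → M, for 1 ≤ i ≤ n and τ ∈ Ψ, such that λ = ∏_{τ∈Ψ} ∏_{i=1}^{n} ξ_{i,τ} ∘ λ_{i,τ}. -/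
namespace Stmt13Aux

variable {U : Type*} [CommGroup U] {n : ℕ}

/-- extend by one to the naturals -/
def ext (y : Fin (2 * n) → U) (k : ℕ) : U := if h : k < 2 * n then y ⟨k, h⟩ else 1

def ell (y : Fin (2 * n) → U) (i : Fin n) : U :=
  (∏ k ∈ Finset.univ.filter (fun k : Fin (2 * n) => (k : ℕ) ≤ (i : ℕ)), y k) *
    (∏ k ∈ Finset.univ.filter
      (fun k : Fin (2 * n) => 2 * n - 1 - (i : ℕ) ≤ (k : ℕ)), y k)⁻¹

lemma ell_eq (y : Fin (2 * n) → U) (i : Fin n) :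
    ell y i = ∏ k ∈ Finset.range (i + 1), (ext y k / ext y (2 * n - 1 - k)) := by
  rw [Finset.prod_div_distrib, div_eq_mul_inv, ell]
  have hi := i.2
  refine congrArg₂ (fun a b : U => a * b⁻¹) ?_ ?_
  · refine Finset.prod_bij (fun k _ => (k : ℕ)) ?_ ?_ ?_ ?_
    · intro a ha; simp at ha ⊢; omega
    · intro a _ b _ h; exact Fin.ext h
    · intro b hb
      simp at hb
      exact ⟨⟨b, by omega⟩, by simp; omega, rfl⟩
    · intro a _; simp [ext]
  · refine Finset.prod_bij (fun k _ => 2 * n - 1 - (k : ℕ)) ?_ ?_ ?_ ?_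
    · intro a ha; have := a.2; simp at ha ⊢; omega
    · intro a _ b _ h
      have := a.2; have := b.2
      apply Fin.ext
      omega
    · intro b hb
      simp at hb
      exact ⟨⟨2 * n - 1 - b, by omega⟩, by simp; omega, by simp; omega⟩
    · intro a _
      have := a.2
      have h : 2 * n - 1 - (2 * n - 1 - (a : ℕ)) = a := by omega
      simp [ext, h]

def sh (v : Fin n → U) (m : ℕ) : U := if h : 0 < m ∧ m - 1 < n then v ⟨m - 1, by omega⟩ else 1

def E (v : Fin n → U) (k : Fin (2 * n)) : U :=
  if (k : ℕ) < n then sh v (k + 1) / sh v k else 1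

lemma sh_mul (v w : Fin n → U) (m : ℕ) : sh (v * w) m = sh v m * sh w m := by
  unfold sh; split_ifs <;> simp

lemma E_mul (v w : Fin n → U) (k) : E (v * w) k = E v k * E w k := by
  unfold E; split_ifs
  · rw [sh_mul, sh_mul, mul_div_mul_comm]
  · simp

lemma sh_one (m : ℕ) : sh (1 : Fin n → U) m = 1 := by
  unfold sh; split_ifs <;> simp

lemma E_one (k) : E (1 : Fin n → U) k = 1 := by
  unfold E; simp [sh_one]

lemma ell_E (v : Fin n → U) (i : Fin n) : ell (E v) i = v i := by
  rw [ell_eq]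
  have hi := i.2
  have : ∀ k ∈ Finset.range ((i : ℕ) + 1),
      ext (E v) k / ext (E v) (2 * n - 1 - k) = sh v (k + 1) / sh v k := by
    intro k hk
    simp at hk
    have h1 : k < 2 * n := by omega
    have h2 : 2 * n - 1 - k < 2 * n := by omega
    have h3 : k < n := by omega
    have h4 : ¬ (2 * n - 1 - k < n) := by omega
    simp only [ext, E, dif_pos h1, dif_pos h2, if_pos h3, if_neg h4, div_one]
  rw [Finset.prod_congr rfl this, Finset.prod_range_div]
  simp [sh]

lemma E_ell (y : Fin (2 * n) → U) (k : Fin (2 * n)) (hk : (k : ℕ) < n) :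
    E (ell y) k = y k / y k.rev := by
  have hs : ∀ m, m ≤ n → sh (ell y) m =
      ∏ k ∈ Finset.range m, (ext y k / ext y (2 * n - 1 - k)) := by
    intro m hm
    rcases m with _ | m
    · simp [sh]
    · have h : 0 < m + 1 ∧ m + 1 - 1 < n := by omega
      rw [sh, dif_pos h, ell_eq]
      rfl
  have h2 : 2 * n - 1 - (k : ℕ) < 2 * n := by omega
  have h3 : (⟨2 * n - 1 - (k : ℕ), h2⟩ : Fin (2 * n)) = k.rev := by
    apply Fin.ext; simp [Fin.val_rev]; omega
  simp only [E, if_pos hk]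
  rw [hs _ hk, hs _ hk.le, Finset.prod_range_succ_div_prod]
  simp only [ext, dif_pos k.2, dif_pos h2, h3]

lemma symm_E (y : Fin (2 * n) → U) (k : Fin (2 * n)) :
    y k / E (ell y) k = y k.rev / E (ell y) k.rev := by
  have hr : (k.rev : ℕ) = 2 * n - (k + 1) := Fin.val_rev k
  by_cases hk : (k : ℕ) < n
  · have h : ¬ ((k.rev : ℕ) < n) := by omega
    rw [E_ell y k hk]
    simp only [E, if_neg h]
    simp
  · have h : (k.rev : ℕ) < n := by omega
    rw [E_ell y k.rev h]
    simp only [E, if_neg hk]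
    simp

lemma continuous_E [TopologicalSpace U] [IsTopologicalGroup U] :
    Continuous (E : (Fin n → U) → Fin (2 * n) → U) := by
  have hs : ∀ m, Continuous (fun v : Fin n → U => sh v m) := by
    intro m
    unfold sh
    split_ifs
    · exact continuous_apply _
    · exact continuous_const
  refine continuous_pi fun k => ?_
  unfold E
  split_ifs
  · exact (hs _).div' (hs _)
  · exact continuous_const

/-- the section as a homomorphism -/
def EE (Ψ : Type*) (n : ℕ) (U : Type*) [CommGroup U] :
    (Ψ → Fin n → U) →* U × (Ψ → Fin (2 * n) → U) where
  toFun v := (1, fun τ => E (v τ))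
  map_one' := by
    ext τ k
    · rfl
    · exact E_one k
  map_mul' v w := by
    ext τ k
    · simp
    · exact E_mul _ _ k

theorem main (Ψ : Type*) [Fintype Ψ] [TopologicalSpace U] [IsTopologicalGroup U]
    (M : Type*) [CommGroup M] [TopologicalSpace M]
    (lam : (U × (Ψ → Fin (2 * n) → U)) →* M)
    (hcont : Continuous lam)
    (htriv : ∀ t : U × (Ψ → Fin (2 * n) → U),
      (∀ (τ : Ψ) (i : Fin (2 * n)), t.2 τ i = t.2 τ i.rev) → lam t = 1) :
    ∃! ξ : Ψ → Fin n → (U →* M),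
      (∀ (τ : Ψ) (i : Fin n), Continuous (ξ τ i)) ∧
      ∀ t : U × (Ψ → Fin (2 * n) → U),
        lam t = ∏ τ : Ψ, ∏ i : Fin n, ξ τ i (ell (t.2 τ) i) := by
  classical
  refine ⟨fun τ i => (lam.comp (EE Ψ n U)).comp
    ((MonoidHom.mulSingle (fun _ : Ψ => Fin n → U) τ).comp
      (MonoidHom.mulSingle (fun _ : Fin n => U) i)), ⟨?_, ?_⟩, ?_⟩
  · intro τ i
    have h1 : Continuous (EE Ψ n U) :=
      continuous_const.prodMk (continuous_pi fun τ => continuous_E.comp (continuous_apply τ))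
    have h2 : Continuous (fun u : U => (Pi.mulSingle i u : Fin n → U)) :=
      continuous_mulSingle (A := fun _ : Fin n => U) i
    have h3 : Continuous (fun u : Fin n → U => (Pi.mulSingle τ u : Ψ → Fin n → U)) :=
      continuous_mulSingle (A := fun _ : Ψ => Fin n → U) τ
    exact (hcont.comp h1).comp (h3.comp h2)
  · intro t
    have h1 : lam t = lam (EE Ψ n U (fun τ => ell (t.2 τ))) := by
      rw [← div_eq_one, ← map_div]
      exact htriv _ fun τ k => symm_E (t.2 τ) k
    have h2 : ∀ w : Ψ → Fin n → U, w = ∏ τ : Ψ, ∏ i : Fin n,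
        MonoidHom.mulSingle (fun _ : Ψ => Fin n → U) τ
          (MonoidHom.mulSingle (fun _ : Fin n => U) i (w τ i)) := by
      intro w
      conv_lhs => rw [← Finset.univ_prod_mulSingle w]
      refine Finset.prod_congr rfl fun τ _ => ?_
      rw [← map_prod]
      conv_lhs => rw [← Finset.univ_prod_mulSingle (w τ)]
      rfl
    rw [h1]
    conv_lhs => rw [h2 (fun τ => ell (t.2 τ))]
    simp only [map_prod]
    rfl
  · rintro ξ ⟨-, hξ⟩
    funext τ i
    ext u
    have h := hξ (EE Ψ n U (Pi.mulSingle τ (Pi.mulSingle i u)))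
    have h3 : ∀ τ' j, ell ((EE Ψ n U (Pi.mulSingle τ (Pi.mulSingle i u))).2 τ') j =
      (Pi.mulSingle τ (Pi.mulSingle i u) : Ψ → Fin n → U) τ' j := fun τ' j => ell_E _ j
    simp only [h3] at h
    rw [Finset.prod_eq_single τ, Finset.prod_eq_single i] at h
    · simp only [Pi.mulSingle_eq_same] at h
      exact h.symm
    · intro j _ hj
      simp [Pi.mulSingle_eq_of_ne hj]
    · simp
    · intro σ _ hσ
      simp [Pi.mulSingle_eq_of_ne hσ]
    · simp

end Stmt13Aux

/-- Every continuous homomorphism `λ` from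
`T = ℤ_p^× × ∏_{τ∈Ψ} (ℤ_p^×)^{2n}` to a commutative topological group `M` that is
trivial on the subgroup `T_0` (where `y_{τ,i} = y_{τ,2n+1−i}` for all `τ, i`)
decomposes uniquely as `λ = ∏_{τ∈Ψ} ∏_{i=1}^{n} ξ_{i,τ} ∘ λ_{i,τ}` with the
`ξ_{i,τ} : ℤ_p^× → M` continuous homomorphisms, where
`λ_{i,τ}(x,y) = (∏_{k=1}^{i} y_{τ,k})·(∏_{k=2n+1−i}^{2n} y_{τ,k})⁻¹`
(here `i : Fin n` denotes the 1-based index `i+1`, and `Fin (2*n)` is 0-based). -/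
theorem stmt13 (p : ℕ) [Fact p.Prime] (n d : ℕ) (hn : 1 ≤ n) (hd : 1 ≤ d)
    (Ψ : Type*) [Fintype Ψ] (hΨ : Fintype.card Ψ = d)
    (M : Type*) [CommGroup M] [TopologicalSpace M] [IsTopologicalGroup M]
    (lam : (ℤ_[p]ˣ × (Ψ → Fin (2 * n) → ℤ_[p]ˣ)) →* M)
    (hcont : Continuous lam)
    (htriv : ∀ t : ℤ_[p]ˣ × (Ψ → Fin (2 * n) → ℤ_[p]ˣ),
      (∀ (τ : Ψ) (i : Fin (2 * n)), t.2 τ i = t.2 τ i.rev) → lam t = 1) :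
    ∃! ξ : Ψ → Fin n → (ℤ_[p]ˣ →* M),
      (∀ (τ : Ψ) (i : Fin n), Continuous (ξ τ i)) ∧
      ∀ t : ℤ_[p]ˣ × (Ψ → Fin (2 * n) → ℤ_[p]ˣ),
        lam t = ∏ τ : Ψ, ∏ i : Fin n,
          ξ τ i
            ((∏ k ∈ Finset.univ.filter (fun k : Fin (2 * n) => (k : ℕ) ≤ (i : ℕ)), t.2 τ k) *
             (∏ k ∈ Finset.univ.filter
                (fun k : Fin (2 * n) => 2 * n - 1 - (i : ℕ) ≤ (k : ℕ)), t.2 τ k)⁻¹) := by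
  exact Stmt13Aux.main Ψ M lam hcont htriv
end

section
/- Let p be a prime, let n ≥ 2 and d ≥ 1 be integers, let Ψ be a finite set of cardinality d with a distinguished element τ₀, and let M be a commutative topological group. Let T = ℤ_p^× × ∏_{τ∈Ψ} (ℤ_p^×)^{2n} and S = ∏_{τ∈Ψ∖{τ₀}} ℤ_p^×. For a continuous homomorphism κ : T → M, let α_0 : ℤ_p^× → M be its restriction to the first factor and α_{i,τ} : ℤ_p^× → M its restriction to the coordinate (i,τ). Define the following continuous homomorphisms T × S → ℤ_p^× (writing (x, y, z) for a general element): ν_0 = x; ν_w = (∏_{k=n+1}^{2n} y_{τ₀,k})^{-1}; ν_{1,τ₀} = y_{τ₀,1}; for 2 ≤ i ≤ n, ν_{i,τ₀} = (∏_{k=2}^{i} y_{τ₀,k})·(∏_{k=2n+2−i}^{2n} y_{τ₀,k})^{-1}; ν_{n+1,τ₀} = (∏_{k=2}^{n} y_{τ₀,k})·(∏_{k=n+1}^{2n} y_{τ₀,k})^{-1}; for τ ≠ τ₀ and 1 ≤ i ≤ n, ν_{i,τ} = (∏_{k=1}^{i} y_{τ,k})·(∏_{k=2n+1−i}^{2n}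 y_{τ,k})^{-1}; and for τ ≠ τ₀, ν'_τ = ν_{n,τ}·z_τ. Suppose κ : T → M and β : S → M are continuous homomorphisms such that the product homomorphism α_{i,τ₀}·α_{2n+2−i,τ₀} is the same for all 2 ≤ i ≤ n and α_{i,τ}·α_{2n+1−i,τ} is trivial for all 1 ≤ i ≤ n and τ ≠ τ₀. Then there exist unique continuous homomorphisms ξ_0, ξ_w, ξ_{n+1,τ₀} : ℤ_p^× → M, ξ_{i,τ} : ℤ_p^× → M for 1 ≤ i ≤ n and τ ∈ Ψ, and Ξ_τ : ℤ_p^× → M for τ ≠ τ₀, such that the homomorphism (t, s) ↦ κ(t)·β(s) on T × S equals (ξ_0∘ν_0)·(ξ_w∘ν_w)·(ξ_{n+1,τ₀}∘ν_{n+1,τ₀})·∏_{τ∈Ψ}∏_{i=1}^{n}(ξ_{i,τ}∘ν_{i,τ})·∏_{τ≠τ₀}(Ξ_τ∘ν'_τ). -/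
/-- The homomorphism `ν_{i,τ}` of the appendix on branching laws, evaluated on
`T = ℤ_p^× × ∏_{τ∈Ψ} (ℤ_p^×)^{2n}`.  Here `i : Fin n` denotes the 1-based index
`i+1`, and `Fin (2*n)` is 0-based.  For `τ = τ₀`: `ν_{1,τ₀} = y_{τ₀,1}` and, for
`2 ≤ i`, `ν_{i,τ₀} = (∏_{k=2}^{i} y_{τ₀,k})·(∏_{k=2n+2−i}^{2n} y_{τ₀,k})⁻¹`;
for `τ ≠ τ₀`: `ν_{i,τ} = (∏_{k=1}^{i} y_{τ,k})·(∏_{k=2n+1−i}^{2n} y_{τ,k})⁻¹`. -/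
noncomputable def nuG (p n : ℕ) [Fact p.Prime] (hn : 0 < n) {Ψ : Type*} [DecidableEq Ψ]
    (τ₀ τ : Ψ) (i : Fin n) (t : ℤ_[p]ˣ × (Ψ → Fin (2 * n) → ℤ_[p]ˣ)) : ℤ_[p]ˣ :=
  if τ = τ₀ then
    (if (i : ℕ) = 0 then t.2 τ ⟨0, by omega⟩
     else
       (∏ k ∈ Finset.univ.filter
          (fun k : Fin (2 * n) => 1 ≤ (k : ℕ) ∧ (k : ℕ) ≤ (i : ℕ)), t.2 τ k) *
       (∏ k ∈ Finset.univ.filter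
          (fun k : Fin (2 * n) => 2 * n - (i : ℕ) ≤ (k : ℕ)), t.2 τ k)⁻¹)
  else
    (∏ k ∈ Finset.univ.filter (fun k : Fin (2 * n) => (k : ℕ) ≤ (i : ℕ)), t.2 τ k) *
    (∏ k ∈ Finset.univ.filter
        (fun k : Fin (2 * n) => 2 * n - 1 - (i : ℕ) ≤ (k : ℕ)), t.2 τ k)⁻¹

namespace Stmt14Aux

section
variable {p n : ℕ} [Fact p.Prime] {Ψ : Type*} [DecidableEq Ψ]

/-- The element with `z` in coordinate `(τ, k)` and `1` elsewhere. -/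
noncomputable def insE (τ : Ψ) (k : Fin (2 * n)) (z : ℤ_[p]ˣ) : ℤ_[p]ˣ × (Ψ → Fin (2 * n) → ℤ_[p]ˣ) :=
  (1, fun τ' i' => if τ' = τ ∧ i' = k then z else 1)

/-- `insE` as a homomorphism. -/
noncomputable def insH (τ : Ψ) (k : Fin (2 * n)) : ℤ_[p]ˣ →* ℤ_[p]ˣ × (Ψ → Fin (2 * n) → ℤ_[p]ˣ) where
  toFun := insE τ k
  map_one' := by
    unfold insE
    ext <;> simp
  map_mul' x y := by
    unfold insE
    refine Prod.ext (by simp) ?_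
    funext τ' i'
    simp only [Prod.snd_mul, Pi.mul_apply]
    split_ifs <;> simp

lemma insH_apply (τ : Ψ) (k : Fin (2 * n)) (z : ℤ_[p]ˣ) : insH τ k z = insE τ k z := rfl

lemma continuous_insH (τ : Ψ) (k : Fin (2 * n)) : Continuous (insH (p := p) τ k) := by
  change Continuous (fun z => ((1, fun τ' i' => if τ' = τ ∧ i' = k then z else 1) :
    ℤ_[p]ˣ × (Ψ → Fin (2 * n) → ℤ_[p]ˣ)))
  refine continuous_const.prodMk (continuous_pi fun a => continuous_pi fun b => ?_)
  split_ifs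
  · exact continuous_id
  · exact continuous_const

lemma prod_ins (τ : Ψ) (k : Fin (2 * n)) (z : ℤ_[p]ˣ) (P : Fin (2 * n) → Prop)
    [DecidablePred P] :
    ∏ k' ∈ Finset.univ.filter P, (insE τ k z).2 τ k' = if P k then z else 1 := by
  simp [insE, Finset.prod_ite_eq']

lemma prod_ins_ne (τ τ' : Ψ) (h : τ' ≠ τ) (k : Fin (2 * n)) (z : ℤ_[p]ˣ)
    (P : Fin (2 * n) → Prop) [DecidablePred P] :
    ∏ k' ∈ Finset.univ.filter P, (insE τ k z).2 τ' k' = 1 := by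
  simp [insE, h]

lemma nuG_one (hn : 0 < n) (τ₀ τ : Ψ) (i : Fin n) : nuG p n hn τ₀ τ i 1 = 1 := by
  unfold nuG
  split_ifs <;> simp

lemma nuG_mul (hn : 0 < n) (τ₀ τ : Ψ) (i : Fin n)
    (t t' : ℤ_[p]ˣ × (Ψ → Fin (2 * n) → ℤ_[p]ˣ)) :
    nuG p n hn τ₀ τ i (t * t') = nuG p n hn τ₀ τ i t * nuG p n hn τ₀ τ i t' := by
  unfold nuG
  split_ifs
  · simp
  · simp only [Prod.snd_mul, Pi.mul_apply, Finset.prod_mul_distrib, mul_inv]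
    exact mul_mul_mul_comm _ _ _ _
  · simp only [Prod.snd_mul, Pi.mul_apply, Finset.prod_mul_distrib, mul_inv]
    exact mul_mul_mul_comm _ _ _ _

lemma nuG_fst (hn : 0 < n) (τ₀ τ : Ψ) (i : Fin n) (x : ℤ_[p]ˣ) :
    nuG p n hn τ₀ τ i (x, 1) = 1 := by
  unfold nuG
  split_ifs <;> simp

lemma nuG_ne (hn : 0 < n) (τ₀ τ τ' : Ψ) (h : τ' ≠ τ) (i : Fin n) (k : Fin (2 * n)) (z : ℤ_[p]ˣ) :
    nuG p n hn τ₀ τ' i (insE τ k z) = 1 := by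
  unfold nuG
  simp only [prod_ins_ne τ τ' h]
  split_ifs <;> simp [insE, h]

lemma nuG_lo (hn : 0 < n) (τ₀ τ : Ψ) (h : τ ≠ τ₀) (i : Fin n) (k : Fin (2 * n)) (hk : (k : ℕ) < n)
    (z : ℤ_[p]ˣ) :
    nuG p n hn τ₀ τ i (insE τ k z) = if (k : ℕ) ≤ i then z else 1 := by
  have := i.isLt
  unfold nuG
  simp only [prod_ins, if_neg h]
  rw [if_neg (show ¬ (2 * n - 1 - (i : ℕ) ≤ k) by omega)]
  simp

lemma nuG_hi (hn : 0 < n) (τ₀ τ : Ψ) (h : τ ≠ τ₀) (i : Fin n) (k : ℕ) (hk : k < n)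
    (z : ℤ_[p]ˣ) :
    nuG p n hn τ₀ τ i (insE τ ⟨2 * n - 1 - k, by omega⟩ z) = if k ≤ i then z⁻¹ else 1 := by
  have := i.isLt
  unfold nuG
  simp only [prod_ins, if_neg h]
  rw [if_neg (show ¬ (2 * n - 1 - k ≤ (i : ℕ)) by omega)]
  have : (2 * n - 1 - (i : ℕ) ≤ 2 * n - 1 - k) ↔ k ≤ i := by omega
  simp only [this]
  split_ifs <;> simp

lemma nuG0_zero (hn : 0 < n) (τ₀ : Ψ) (i : Fin n) (z : ℤ_[p]ˣ) :
    nuG p n hn τ₀ τ₀ i (insE τ₀ ⟨0, by omega⟩ z) = if (i : ℕ) = 0 then z else 1 := by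
  have := i.isLt
  unfold nuG
  simp only [prod_ins, if_true]
  split_ifs <;> first | omega | simp [insE]

lemma nuG0_lo (hn : 0 < n) (τ₀ : Ψ) (i : Fin n) (k : Fin (2 * n)) (h1 : 1 ≤ (k : ℕ))
    (hk : (k : ℕ) < n) (z : ℤ_[p]ˣ) :
    nuG p n hn τ₀ τ₀ i (insE τ₀ k z) = if (k : ℕ) ≤ i then z else 1 := by
  have := i.isLt
  have h0 : (⟨0, by omega⟩ : Fin (2 * n)) ≠ k := by
    intro h; rw [← h] at h1; simp at h1
  unfold nuG
  simp only [prod_ins, if_true]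
  split_ifs <;> first | omega | simp [insE, h0]

lemma nuG0_mid (hn : 0 < n) (τ₀ : Ψ) (i : Fin n) (z : ℤ_[p]ˣ) :
    nuG p n hn τ₀ τ₀ i (insE τ₀ ⟨n, by omega⟩ z) = 1 := by
  have := i.isLt
  unfold nuG
  simp only [prod_ins, if_true]
  split_ifs <;> first | omega | simp [insE]
  omega

lemma nuG0_hi (hn : 0 < n) (τ₀ : Ψ) (i : Fin n) (k : ℕ) (h1 : 1 ≤ k)
    (hk : k < n) (z : ℤ_[p]ˣ) :
    nuG p n hn τ₀ τ₀ i (insE τ₀ ⟨2 * n - k, by omega⟩ z) = if k ≤ i then z⁻¹ else 1 := by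
  have := i.isLt
  unfold nuG
  simp only [prod_ins, if_true]
  split_ifs <;> first | omega | simp [insE]
  omega

variable {M : Type*} [CommGroup M]

/-- Suffix products. -/
noncomputable def suf {H : Type*} [CommGroup H] (f : Fin n → H) (k : ℕ) : H :=
  ∏ i : Fin n, if k ≤ (i : ℕ) then f i else 1

lemma suf_n {H : Type*} [CommGroup H] (f : Fin n → H) (k : ℕ) (hk : n ≤ k) : suf f k = 1 := by
  unfold suf
  refine Finset.prod_eq_one fun i _ => ?_
  rw [if_neg]
  have := i.isLt
  omega

lemma suf_succ {H : Type*} [CommGroup H] (f : Fin n → H) (k : ℕ) (hk : k < n) :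
    suf f k = f ⟨k, hk⟩ * suf f (k + 1) := by
  unfold suf
  rw [← Finset.mul_prod_erase _ _ (Finset.mem_univ (⟨k, hk⟩ : Fin n)),
    ← Finset.mul_prod_erase _ (fun i : Fin n => if k + 1 ≤ (i : ℕ) then f i else 1)
      (Finset.mem_univ (⟨k, hk⟩ : Fin n))]
  simp only [le_refl, if_true]
  rw [if_neg (by omega), one_mul]
  congr 1
  refine Finset.prod_congr rfl fun i hi => ?_
  have : (i : ℕ) ≠ k := fun h => (Finset.mem_erase.1 hi).1 (Fin.ext h)
  have : (k ≤ (i : ℕ)) ↔ k + 1 ≤ (i : ℕ) := by omega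
  simp only [this]

lemma suf_tele {H : Type*} [CommGroup H] (f : Fin n → H) (A : ℕ → H) (hA : A n = 1) (k0 : ℕ)
    (hf : ∀ i : Fin n, k0 ≤ (i : ℕ) → f i = A i / A (i + 1)) (k : ℕ) (hk0 : k0 ≤ k) (hk : k ≤ n) :
    suf f k = A k := by
  induction hk using Nat.decreasingInduction with
  | self => rw [suf_n _ _ le_rfl, hA]
  | of_succ k hk ih =>
    rw [suf_succ f k hk, ih (by omega), hf ⟨k, hk⟩ hk0]
    simp

lemma suf_apply {G : Type*} [CommGroup G] (f : Fin n → (G →* M)) (k : ℕ) (z : G) :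
    suf f k z = ∏ i : Fin n, f i (if k ≤ (i : ℕ) then z else 1) := by
  unfold suf
  rw [MonoidHom.finsetProd_apply]
  refine Finset.prod_congr rfl fun i _ => ?_
  split_ifs <;> simp

lemma suf_apply_inv {G : Type*} [CommGroup G] (f : Fin n → (G →* M)) (k : ℕ) (z : G) :
    ∏ i : Fin n, f i (if k ≤ (i : ℕ) then z⁻¹ else 1) = (suf f k z)⁻¹ := by
  rw [← suf_apply, map_inv]

variable [Fintype Ψ]

/-- The right-hand side as a homomorphism. -/
noncomputable def rhs (hn : 2 ≤ n) (τ₀ : Ψ) (Z : (ℤ_[p]ˣ →* M) × (ℤ_[p]ˣ →* M) × (ℤ_[p]ˣ →* M) ×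
        (Ψ → Fin n → (ℤ_[p]ˣ →* M)) × ({τ : Ψ // τ ≠ τ₀} → (ℤ_[p]ˣ →* M))) :
    (ℤ_[p]ˣ × (Ψ → Fin (2 * n) → ℤ_[p]ˣ)) × ({τ : Ψ // τ ≠ τ₀} → ℤ_[p]ˣ) →* M where
  toFun q := Z.1 q.1.1 *
          Z.2.1 ((∏ k ∈ Finset.univ.filter
              (fun k : Fin (2 * n) => n ≤ (k : ℕ)), q.1.2 τ₀ k)⁻¹) *
          Z.2.2.1
            ((∏ k ∈ Finset.univ.filter
                (fun k : Fin (2 * n) => 1 ≤ (k : ℕ) ∧ (k : ℕ) < n), q.1.2 τ₀ k) *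
             (∏ k ∈ Finset.univ.filter
                (fun k : Fin (2 * n) => n ≤ (k : ℕ)), q.1.2 τ₀ k)⁻¹) *
          (∏ τ : Ψ, ∏ i : Fin n,
            Z.2.2.2.1 τ i (nuG p n (by omega) τ₀ τ i q.1)) *
          (∏ τ : {τ : Ψ // τ ≠ τ₀},
            Z.2.2.2.2 τ (nuG p n (by omega) τ₀ τ.1 ⟨n - 1, by omega⟩ q.1 * q.2 τ))
  map_one' := by simp [nuG_one]
  map_mul' q q' := by
    simp only [Prod.fst_mul, Prod.snd_mul, Pi.mul_apply, nuG_mul, Finset.prod_mul_distrib,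
      map_mul, mul_inv]
    ac_rfl

lemma hom_ext (τ₀ : Ψ)
    (f g : (ℤ_[p]ˣ × (Ψ → Fin (2 * n) → ℤ_[p]ˣ)) × ({τ : Ψ // τ ≠ τ₀} → ℤ_[p]ˣ) →* M)
    (h0 : ∀ x, f ((x, 1), 1) = g ((x, 1), 1))
    (h1 : ∀ τ k z, f (insE τ k z, 1) = g (insE τ k z, 1))
    (h2 : ∀ τ z, f (1, Pi.mulSingle τ z) = g (1, Pi.mulSingle τ z)) : f = g := by
  refine MonoidHom.ext fun q => ?_
  obtain ⟨⟨x, y⟩, s⟩ := q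
  have e : (((x, y), s) : (ℤ_[p]ˣ × (Ψ → Fin (2 * n) → ℤ_[p]ˣ)) × ({τ : Ψ // τ ≠ τ₀} → ℤ_[p]ˣ)) =
      ((x, 1), 1) * ((∏ τ, ∏ k, (insE τ k (y τ k), 1)) * ∏ τ, (1, Pi.mulSingle τ (s τ))) := by
    refine Prod.ext (Prod.ext ?_ ?_) ?_
    · simp [Prod.fst_prod, insE]
    · funext τ k
      simp [Prod.fst_prod, Prod.snd_prod, insE, Finset.prod_apply, ite_and]
    · simp [Prod.snd_prod, Finset.univ_prod_mulSingle]
  rw [e]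
  simp only [map_mul, map_prod, h0, h1, h2]

variable (hn : 2 ≤ n) (τ₀ : Ψ) (Z : (ℤ_[p]ˣ →* M) × (ℤ_[p]ˣ →* M) × (ℤ_[p]ˣ →* M) ×
        (Ψ → Fin n → (ℤ_[p]ˣ →* M)) × ({τ : Ψ // τ ≠ τ₀} → (ℤ_[p]ˣ →* M)))

lemma rhs_apply (t : ℤ_[p]ˣ × (Ψ → Fin (2 * n) → ℤ_[p]ˣ)) (s : {τ : Ψ // τ ≠ τ₀} → ℤ_[p]ˣ) :
    rhs hn τ₀ Z (t, s) = Z.1 t.1 *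
          Z.2.1 ((∏ k ∈ Finset.univ.filter
              (fun k : Fin (2 * n) => n ≤ (k : ℕ)), t.2 τ₀ k)⁻¹) *
          Z.2.2.1
            ((∏ k ∈ Finset.univ.filter
                (fun k : Fin (2 * n) => 1 ≤ (k : ℕ) ∧ (k : ℕ) < n), t.2 τ₀ k) *
             (∏ k ∈ Finset.univ.filter
                (fun k : Fin (2 * n) => n ≤ (k : ℕ)), t.2 τ₀ k)⁻¹) *
          (∏ τ : Ψ, ∏ i : Fin n,
            Z.2.2.2.1 τ i (nuG p n (by omega) τ₀ τ i t)) *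
          (∏ τ : {τ : Ψ // τ ≠ τ₀},
            Z.2.2.2.2 τ (nuG p n (by omega) τ₀ τ.1 ⟨n - 1, by omega⟩ t * s τ)) := rfl

lemma rhs_fst (x : ℤ_[p]ˣ) : rhs hn τ₀ Z ((x, 1), 1) = Z.1 x := by
  rw [rhs_apply]
  simp [nuG_fst]

lemma rhs_snd (τ : {τ : Ψ // τ ≠ τ₀}) (z : ℤ_[p]ˣ) :
    rhs hn τ₀ Z (1, Pi.mulSingle τ z) = Z.2.2.2.2 τ z := by
  rw [rhs_apply, Finset.prod_eq_single τ (f := fun τ' : {τ : Ψ // τ ≠ τ₀} =>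
    Z.2.2.2.2 τ' (nuG p n (by omega) τ₀ τ'.1 ⟨n - 1, by omega⟩ 1 *
      (Pi.mulSingle τ z : {τ : Ψ // τ ≠ τ₀} → ℤ_[p]ˣ) τ'))]
  · simp [nuG_one]
  · intro b _ hb
    simp [nuG_one, hb]
  · simp

lemma prod_nu (τ : Ψ) (k : Fin (2 * n)) (z : ℤ_[p]ˣ) (a : Ψ → Fin n → (ℤ_[p]ˣ →* M)) :
    (∏ τ' : Ψ, ∏ i : Fin n, a τ' i (nuG p n (by omega) τ₀ τ' i (insE τ k z))) =
      ∏ i : Fin n, a τ i (nuG p n (by omega) τ₀ τ i (insE τ k z)) := by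
  refine Finset.prod_eq_single τ ?_ (by simp)
  intro b _ hb
  simp [nuG_ne _ τ₀ τ b hb]

lemma rhs_ins0 (k : Fin (2 * n)) (z : ℤ_[p]ˣ) :
    rhs hn τ₀ Z (insE τ₀ k z, 1) =
      Z.2.1 ((if n ≤ (k : ℕ) then z else 1)⁻¹) *
      Z.2.2.1 ((if 1 ≤ (k : ℕ) ∧ (k : ℕ) < n then z else 1) *
        (if n ≤ (k : ℕ) then z else 1)⁻¹) *
      ∏ i : Fin n, Z.2.2.2.1 τ₀ i (nuG p n (by omega) τ₀ τ₀ i (insE τ₀ k z)) := by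
  rw [rhs_apply, prod_nu hn]
  simp only [prod_ins]
  have : ∀ τ : {τ : Ψ // τ ≠ τ₀}, nuG p n (by omega) τ₀ τ.1 ⟨n - 1, by omega⟩ (insE τ₀ k z) = 1 :=
    fun τ => nuG_ne _ τ₀ τ₀ τ.1 τ.2 _ _ _
  simp only [this]
  simp [insE]

lemma rhs_insne (τ : {τ : Ψ // τ ≠ τ₀}) (k : Fin (2 * n)) (z : ℤ_[p]ˣ) :
    rhs hn τ₀ Z (insE τ.1 k z, 1) =
      Z.2.2.2.2 τ (nuG p n (by omega) τ₀ τ.1 ⟨n - 1, by omega⟩ (insE τ.1 k z)) *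
      ∏ i : Fin n, Z.2.2.2.1 τ.1 i (nuG p n (by omega) τ₀ τ.1 i (insE τ.1 k z)) := by
  rw [rhs_apply, prod_nu hn, Finset.prod_eq_single τ (f := fun τ' : {τ : Ψ // τ ≠ τ₀} =>
    Z.2.2.2.2 τ' (nuG p n (by omega) τ₀ τ'.1 ⟨n - 1, by omega⟩ (insE τ.1 k z) * (1 :
      {τ : Ψ // τ ≠ τ₀} → ℤ_[p]ˣ) τ'))]
  · simp only [prod_ins_ne τ.1 τ₀ τ.2.symm]
    simp only [Pi.one_apply, mul_one, inv_one, map_one]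
    rw [show (insE τ.1 k z).1 = 1 from rfl, map_one, one_mul, mul_comm]
  · intro b _ hb
    rw [nuG_ne _ τ₀ τ.1 b.1 (fun h => hb (Subtype.ext h))]
    simp
  · simp

lemma c1 (z : ℤ_[p]ˣ) :
    rhs hn τ₀ Z (insE τ₀ ⟨0, by omega⟩ z, 1) = Z.2.2.2.1 τ₀ ⟨0, by omega⟩ z := by
  rw [rhs_ins0]
  simp only [nuG0_zero]
  rw [Finset.prod_eq_single (⟨0, by omega⟩ : Fin n)]
  · rw [if_neg (by simp; omega), if_neg (by simp)]
    simp
  · intro b _ hb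
    rw [if_neg (fun h => hb (Fin.ext h))]
    simp
  · simp

lemma c2 (k : Fin (2 * n)) (h1 : 1 ≤ (k : ℕ)) (h2 : (k : ℕ) < n) (z : ℤ_[p]ˣ) :
    rhs hn τ₀ Z (insE τ₀ k z, 1) = (Z.2.2.1 * suf (Z.2.2.2.1 τ₀) k) z := by
  rw [rhs_ins0]
  simp only [nuG0_lo _ τ₀ _ k h1 h2, ← suf_apply]
  rw [if_neg (by omega), if_pos ⟨h1, h2⟩]
  simp

lemma c3 (z : ℤ_[p]ˣ) :
    rhs hn τ₀ Z (insE τ₀ ⟨n, by omega⟩ z, 1) = (Z.2.1 * Z.2.2.1)⁻¹ z := by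
  rw [rhs_ins0]
  simp only [nuG0_mid]
  simp [mul_comm]

lemma c4 (k : ℕ) (h1 : 1 ≤ k) (h2 : k < n) (z : ℤ_[p]ˣ) :
    rhs hn τ₀ Z (insE τ₀ ⟨2 * n - k, by omega⟩ z, 1) =
      (Z.2.1 * (Z.2.2.1 * suf (Z.2.2.2.1 τ₀) k))⁻¹ z := by
  rw [rhs_ins0]
  simp only [nuG0_hi _ τ₀ _ k h1 h2, suf_apply_inv]
  rw [if_pos (by omega), if_neg (by omega)]
  simp only [one_mul, map_inv, MonoidHom.inv_apply, MonoidHom.mul_apply, mul_inv, mul_assoc]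

lemma c5 (τ : {τ : Ψ // τ ≠ τ₀}) (k : Fin (2 * n)) (h2 : (k : ℕ) < n) (z : ℤ_[p]ˣ) :
    rhs hn τ₀ Z (insE τ.1 k z, 1) = (Z.2.2.2.2 τ * suf (Z.2.2.2.1 τ.1) k) z := by
  rw [rhs_insne]
  simp only [nuG_lo _ τ₀ τ.1 τ.2 _ k h2, ← suf_apply]
  rw [if_pos (by omega)]
  simp

lemma c6 (τ : {τ : Ψ // τ ≠ τ₀}) (k : ℕ) (h2 : k < n) (z : ℤ_[p]ˣ) :
    rhs hn τ₀ Z (insE τ.1 ⟨2 * n - 1 - k, by omega⟩ z, 1) =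
      (Z.2.2.2.2 τ * suf (Z.2.2.2.1 τ.1) k)⁻¹ z := by
  rw [rhs_insne]
  simp only [nuG_hi _ τ₀ τ.1 τ.2 _ k h2, suf_apply_inv]
  rw [if_pos (by omega)]
  simp [mul_comm]


/-- Coordinate restrictions `α_{k,τ}` of `κ`, indexed by natural numbers. -/
noncomputable def al (κ : (ℤ_[p]ˣ × (Ψ → Fin (2 * n) → ℤ_[p]ˣ)) →* M) (τ : Ψ) (k : ℕ) :
    ℤ_[p]ˣ →* M :=
  if h : k < 2 * n then κ.comp (insH τ ⟨k, h⟩) else 1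

lemma al_apply (κ : (ℤ_[p]ˣ × (Ψ → Fin (2 * n) → ℤ_[p]ˣ)) →* M) (τ : Ψ) (k : ℕ)
    (h : k < 2 * n) (z : ℤ_[p]ˣ) : al κ τ k z = κ (insE τ ⟨k, h⟩ z) := by
  unfold al
  rw [dif_pos h]
  rfl

lemma continuous_al [TopologicalSpace M]
    (κ : (ℤ_[p]ˣ × (Ψ → Fin (2 * n) → ℤ_[p]ˣ)) →* M) (hκ : Continuous κ) (τ : Ψ) (k : ℕ) :
    Continuous (al κ τ k) := by
  unfold al
  split_ifs with h
  · exact hκ.comp (continuous_insH τ _)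
  · exact continuous_const

lemma key (κ : (ℤ_[p]ˣ × (Ψ → Fin (2 * n) → ℤ_[p]ˣ)) →* M)
    (β : ({τ : Ψ // τ ≠ τ₀} → ℤ_[p]ˣ) →* M) :
    (∀ t s, κ t * β s = rhs hn τ₀ Z (t, s)) ↔
      (Z.1 = κ.comp (MonoidHom.inl _ _) ∧
      al κ τ₀ 0 = Z.2.2.2.1 τ₀ ⟨0, by omega⟩ ∧
      (∀ k, 1 ≤ k → k < n → al κ τ₀ k = Z.2.2.1 * suf (Z.2.2.2.1 τ₀) k) ∧
      al κ τ₀ n = (Z.2.1 * Z.2.2.1)⁻¹ ∧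
      (∀ k, 1 ≤ k → k < n → al κ τ₀ (2 * n - k) =
        (Z.2.1 * (Z.2.2.1 * suf (Z.2.2.2.1 τ₀) k))⁻¹) ∧
      (∀ (τ : {τ : Ψ // τ ≠ τ₀}) k, k < n →
        al κ τ.1 k = Z.2.2.2.2 τ * suf (Z.2.2.2.1 τ.1) k) ∧
      (∀ (τ : {τ : Ψ // τ ≠ τ₀}) k, k < n →
        al κ τ.1 (2 * n - 1 - k) = (Z.2.2.2.2 τ * suf (Z.2.2.2.1 τ.1) k)⁻¹) ∧
      (∀ τ : {τ : Ψ // τ ≠ τ₀}, Z.2.2.2.2 τ = β.comp (MonoidHom.mulSingle (fun _ : {τ : Ψ // τ ≠ τ₀} => ℤ_[p]ˣ) τ))) := by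
  constructor
  · intro H
    have H1 : ∀ τ k z, κ (insE τ k z) = rhs hn τ₀ Z (insE τ k z, 1) := by
      intro τ k z
      rw [← H, map_one, mul_one]
    refine ⟨?_, ?_, ?_, ?_, ?_, ?_, ?_, ?_⟩
    · ext x
      have := H (x, 1) 1
      rw [rhs_fst, map_one, mul_one] at this
      exact this.symm
    · ext z
      rw [al_apply _ _ _ (by omega), H1, c1]
    · intro k h1 h2
      ext z
      rw [al_apply _ _ _ (by omega), H1, c2 hn τ₀ Z ⟨k, by omega⟩ h1 h2]
    · ext z
      rw [al_apply _ _ _ (by omega), H1, c3]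
    · intro k h1 h2
      ext z
      rw [al_apply _ _ _ (by omega), H1, c4 hn τ₀ Z k h1 h2]
    · intro τ k h2
      ext z
      rw [al_apply _ _ _ (by omega), H1, c5 hn τ₀ Z τ ⟨k, by omega⟩ h2]
    · intro τ k h2
      ext z
      rw [al_apply _ _ _ (by omega), H1, c6 hn τ₀ Z τ k h2]
    · intro τ
      ext z
      have := H 1 (Pi.mulSingle τ z)
      rw [rhs_snd, map_one, one_mul] at this
      exact this.symm
  · rintro ⟨e0, e1, e2, e3, e4, e5, e6, e7⟩
    have : κ.coprod β = rhs hn τ₀ Z := by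
      refine hom_ext τ₀ _ _ ?_ ?_ ?_
      · intro x
        rw [rhs_fst, e0]
        simp
      · intro τ k z
        simp only [MonoidHom.coprod_apply, map_one, mul_one]
        rw [← al_apply κ τ k k.isLt z]
        have hk := k.isLt
        by_cases hτ : τ = τ₀
        · subst hτ
          obtain ⟨k, hk'⟩ := k
          simp only at hk ⊢
          rcases Nat.eq_zero_or_pos k with h0 | h0
          · subst h0
            rw [e1, c1]
          rcases lt_trichotomy k n with h | h | h
          · rw [e2 k h0 h, c2 hn τ Z ⟨k, hk⟩ h0 h]
          · subst h
            rw [e3, c3]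
          · obtain ⟨m, rfl, hm1, hm2⟩ : ∃ m, k = 2 * n - m ∧ 1 ≤ m ∧ m < n :=
              ⟨2 * n - k, by omega, by omega, by omega⟩
            rw [e4 m hm1 hm2, c4 hn τ Z m hm1 hm2]
        · obtain ⟨k, hk'⟩ := k
          simp only at hk ⊢
          rcases lt_or_ge k n with h | h
          · rw [e5 ⟨τ, hτ⟩ k h, ← c5 hn τ₀ Z ⟨τ, hτ⟩ ⟨k, hk⟩ h]
          · obtain ⟨m, rfl, hm2⟩ : ∃ m, k = 2 * n - 1 - m ∧ m < n :=
              ⟨2 * n - 1 - k, by omega, by omega⟩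
            rw [e6 ⟨τ, hτ⟩ m hm2, ← c6 hn τ₀ Z ⟨τ, hτ⟩ m hm2]
      · intro τ z
        rw [rhs_snd, e7]
        simp
    intro t s
    rw [← this]
    simp

end

end Stmt14Aux

/-- Unique decomposition of a pair of continuous homomorphisms
`(κ, β)` on `T × S` (satisfying the stated purity-type conditions on the
coordinate restrictions of `κ`) in terms of the generators
`ν_0, ν_w, ν_{n+1,τ₀}, ν_{i,τ}, ν'_τ` of the appendix on branching laws.
Here `ins τ i z` is the element of `T` with `z` in coordinate `(i,τ)` and `1`
elsewhere, so `z ↦ κ (ins τ i z)` is the restriction `α_{i,τ}` of `κ`. -/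
theorem stmt14 (p : ℕ) [Fact p.Prime] (n d : ℕ) (hn : 2 ≤ n) (hd : 1 ≤ d)
    (Ψ : Type*) [Fintype Ψ] [DecidableEq Ψ] (hΨ : Fintype.card Ψ = d) (τ₀ : Ψ)
    (M : Type*) [CommGroup M] [TopologicalSpace M] [IsTopologicalGroup M]
    (κ : (ℤ_[p]ˣ × (Ψ → Fin (2 * n) → ℤ_[p]ˣ)) →* M)
    (β : ({τ : Ψ // τ ≠ τ₀} → ℤ_[p]ˣ) →* M)
    (hκ : Continuous κ) (hβ : Continuous β)
    (ins : Ψ → Fin (2 * n) → ℤ_[p]ˣ → ℤ_[p]ˣ × (Ψ → Fin (2 * n) → ℤ_[p]ˣ))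
    (hins : ∀ τ i z, ins τ i z =
      (1, fun τ' i' => if τ' = τ ∧ i' = i then z else 1))
    (hpure : ∀ i i' : Fin (2 * n), ∀ _h1 : 1 ≤ (i : ℕ), ∀ _h2 : (i : ℕ) < n,
      ∀ _h3 : 1 ≤ (i' : ℕ), ∀ _h4 : (i' : ℕ) < n, ∀ z : ℤ_[p]ˣ,
      κ (ins τ₀ i z) * κ (ins τ₀ ⟨2 * n - (i : ℕ), by have := i.isLt; omega⟩ z) =
        κ (ins τ₀ i' z) * κ (ins τ₀ ⟨2 * n - (i' : ℕ), by have := i'.isLt; omega⟩ z))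
    (htriv : ∀ τ : Ψ, τ ≠ τ₀ → ∀ i : Fin (2 * n), (i : ℕ) < n → ∀ z : ℤ_[p]ˣ,
      κ (ins τ i z) * κ (ins τ i.rev z) = 1) :
    ∃! Z : (ℤ_[p]ˣ →* M) × (ℤ_[p]ˣ →* M) × (ℤ_[p]ˣ →* M) ×
        (Ψ → Fin n → (ℤ_[p]ˣ →* M)) × ({τ : Ψ // τ ≠ τ₀} → (ℤ_[p]ˣ →* M)),
      (Continuous Z.1 ∧ Continuous Z.2.1 ∧ Continuous Z.2.2.1 ∧
        (∀ (τ : Ψ) (i : Fin n), Continuous (Z.2.2.2.1 τ i)) ∧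
        (∀ τ : {τ : Ψ // τ ≠ τ₀}, Continuous (Z.2.2.2.2 τ))) ∧
      ∀ (t : ℤ_[p]ˣ × (Ψ → Fin (2 * n) → ℤ_[p]ˣ)) (s : {τ : Ψ // τ ≠ τ₀} → ℤ_[p]ˣ),
        κ t * β s =
          Z.1 t.1 *
          Z.2.1 ((∏ k ∈ Finset.univ.filter
              (fun k : Fin (2 * n) => n ≤ (k : ℕ)), t.2 τ₀ k)⁻¹) *
          Z.2.2.1
            ((∏ k ∈ Finset.univ.filter
                (fun k : Fin (2 * n) => 1 ≤ (k : ℕ) ∧ (k : ℕ) < n), t.2 τ₀ k) *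
             (∏ k ∈ Finset.univ.filter
                (fun k : Fin (2 * n) => n ≤ (k : ℕ)), t.2 τ₀ k)⁻¹) *
          (∏ τ : Ψ, ∏ i : Fin n,
            Z.2.2.2.1 τ i (nuG p n (by omega) τ₀ τ i t)) *
          (∏ τ : {τ : Ψ // τ ≠ τ₀},
            Z.2.2.2.2 τ (nuG p n (by omega) τ₀ τ.1 ⟨n - 1, by omega⟩ t * s τ)) := by
  classical
  obtain rfl : ins = Stmt14Aux.insE := by
    funext τ i z
    exact hins τ i z
  have hp : ∀ k, 1 ≤ k → k < n → Stmt14Aux.al κ τ₀ k * Stmt14Aux.al κ τ₀ (2 * n - k) =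
      Stmt14Aux.al κ τ₀ 1 * Stmt14Aux.al κ τ₀ (2 * n - 1) := by
    intro k h1 h2
    ext1 z
    simp only [MonoidHom.mul_apply]
    rw [Stmt14Aux.al_apply _ _ _ (by omega), Stmt14Aux.al_apply _ _ _ (by omega),
      Stmt14Aux.al_apply _ _ _ (by omega), Stmt14Aux.al_apply _ _ _ (by omega)]
    exact hpure ⟨k, by omega⟩ ⟨1, by omega⟩ h1 h2 le_rfl hn z
  have ht : ∀ τ, τ ≠ τ₀ → ∀ k, k < n →
      Stmt14Aux.al κ τ k * Stmt14Aux.al κ τ (2 * n - 1 - k) = 1 := by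
    intro τ hτ k hk
    ext1 z
    simp only [MonoidHom.mul_apply]
    rw [Stmt14Aux.al_apply _ _ _ (by omega), Stmt14Aux.al_apply _ _ _ (by omega)]
    have := htriv τ hτ ⟨k, by omega⟩ hk z
    have e : (⟨k, by omega⟩ : Fin (2 * n)).rev = ⟨2 * n - 1 - k, by omega⟩ := by
      ext
      simp only [Fin.val_rev]
      omega
    rw [e] at this
    exact this
  have hcal := Stmt14Aux.continuous_al κ hκ
  set al := Stmt14Aux.al κ with hal
  set w : ℤ_[p]ˣ →* M := (al τ₀ 1 * al τ₀ (2 * n - 1))⁻¹ with hw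
  set b : ℤ_[p]ˣ →* M := (al τ₀ n)⁻¹ * w⁻¹ with hb
  set bt : {τ : Ψ // τ ≠ τ₀} → (ℤ_[p]ˣ →* M) := fun τ => β.comp (MonoidHom.mulSingle (fun _ : {τ : Ψ // τ ≠ τ₀} => ℤ_[p]ˣ) τ) with hbt
  set c : Ψ → (ℤ_[p]ˣ →* M) := fun τ => if h : τ = τ₀ then b else bt ⟨τ, h⟩ with hc
  set A : Ψ → ℕ → (ℤ_[p]ˣ →* M) := fun τ k => if k < n then al τ k / c τ else 1 with hA
  set a : Ψ → Fin n → (ℤ_[p]ˣ →* M) := fun τ i =>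
    if τ = τ₀ ∧ (i : ℕ) = 0 then al τ 0 else A τ i / A τ (i + 1) with ha
  have c0 : c τ₀ = b := by simp [hc]
  have c1 : ∀ τ : {τ : Ψ // τ ≠ τ₀}, c τ.1 = bt τ := by
    intro τ
    simp [hc, τ.2]
  have An : ∀ τ, A τ n = 1 := by intro τ; simp [hA]
  have Alt : ∀ τ k, k < n → A τ k = al τ k / c τ := by intro τ k hk; simp [hA, hk]
  have cw : Continuous w := by
    have : Continuous fun z => (al τ₀ 1 z * al τ₀ (2 * n - 1) z)⁻¹ :=
      ((hcal _ _).mul (hcal _ _)).inv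
    exact this
  have cb : Continuous b := by
    have : Continuous fun z => (al τ₀ n z)⁻¹ * (w z)⁻¹ := (hcal _ _).inv.mul cw.inv
    exact this
  have cbt : ∀ τ, Continuous (bt τ) := fun τ => hβ.comp 
    (continuous_mulSingle (A := fun _ : {τ : Ψ // τ ≠ τ₀} => ℤ_[p]ˣ) τ)
  have cc : ∀ τ, Continuous (c τ) := by
    intro τ
    by_cases h : τ = τ₀
    · rw [h, c0]; exact cb
    · rw [c1 ⟨τ, h⟩]; exact cbt _
  have cA : ∀ τ k, Continuous (A τ k) := by
    intro τ k
    by_cases h : k < n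
    · rw [Alt τ k h]
      have : Continuous fun z => al τ k z / c τ z := (hcal _ _).div' (cc _)
      exact this
    · simp only [hA, if_neg h]
      exact continuous_const
  have ca : ∀ τ i, Continuous (a τ i) := by
    intro τ i
    by_cases h : τ = τ₀ ∧ (i : ℕ) = 0
    · simp only [ha, if_pos h]
      exact hcal _ _
    · simp only [ha, if_neg h]
      have : Continuous fun z => A τ i z / A τ (i + 1) z := (cA _ _).div' (cA _ _)
      exact this
  have s0 : ∀ k, 1 ≤ k → k < n → Stmt14Aux.suf (a τ₀) k = al τ₀ k / b := by
    intro k h1 h2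
    rw [Stmt14Aux.suf_tele (a τ₀) (A τ₀) (An _) 1 _ k h1 h2.le, Alt _ _ h2, c0]
    intro i hi
    simp only [ha]
    rw [if_neg (by omega)]
  have s1 : ∀ (τ : {τ : Ψ // τ ≠ τ₀}) k, k < n →
      Stmt14Aux.suf (a τ.1) k = al τ.1 k / bt τ := by
    intro τ k h2
    rw [Stmt14Aux.suf_tele (a τ.1) (A τ.1) (An _) 0 _ k (Nat.zero_le _) h2.le, Alt _ _ h2, c1]
    intro i hi
    simp only [ha]
    rw [if_neg (fun h => τ.2 h.1)]
  refine ⟨(κ.comp (MonoidHom.inl _ _), w, b, a, bt), ⟨⟨?_, cw, cb, ca, cbt⟩, ?_⟩, ?_⟩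
  · exact hκ.comp (continuous_id.prodMk continuous_const)
  · refine (Stmt14Aux.key hn τ₀ (κ.comp (MonoidHom.inl _ _), w, b, a, bt) κ β).2
      ⟨rfl, ?_, ?_, ?_, ?_, ?_, ?_, fun _ => rfl⟩
    · simp [ha, hal]
    · intro k h1 h2
      simp only [s0 k h1 h2]
      simp [hal]
    · simp only [hb]
      simp [hal]
    · intro k h1 h2
      simp only [s0 k h1 h2]
      rw [mul_div_cancel, hw, ← hp k h1 h2]
      simp [hal]
    · intro τ k h2
      simp only [s1 τ k h2]
      simp [hal]
    · intro τ k h2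
      simp only [s1 τ k h2]
      rw [mul_div_cancel]
      exact eq_inv_of_mul_eq_one_right (ht τ.1 τ.2 k h2)
  · rintro Z ⟨-, hZ⟩
    obtain ⟨e0, e1, e2, e3, e4, e5, e6, e7⟩ := (Stmt14Aux.key hn τ₀ Z κ β).1 hZ
    rw [← hal] at e1 e2 e3 e4 e5 e6
    obtain ⟨z0, zw, zb, za, zt⟩ := Z
    simp only at e0 e1 e2 e3 e4 e5 e6 e7
    have f1 : zw = w := by
      rw [hw, e2 1 le_rfl (by omega), e4 1 le_rfl (by omega)]
      generalize zb * Stmt14Aux.suf (za τ₀) 1 = q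
      rw [mul_inv, inv_inv, mul_comm zw q, inv_mul_cancel_left]
    have f2 : zb = b := by
      rw [hb, e3, ← f1]
      simp
    have f3 : zt = bt := funext e7
    have f4 : za = a := by
      funext τ i
      have hi := i.isLt
      have g := Stmt14Aux.suf_succ (za τ) i hi
      by_cases h : τ = τ₀
      · subst h
        by_cases h0 : (i : ℕ) = 0
        · obtain ⟨i, hi'⟩ := i
          simp only at h0
          subst h0
          simp only [ha]
          rw [if_pos (by simp), e1]
        · have S : ∀ k, 1 ≤ k → k ≤ n → Stmt14Aux.suf (za τ) k = A τ k := by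
            intro k h1 h2
            rcases h2.lt_or_eq with h2 | h2
            · rw [Alt _ _ h2, c0, e2 k h1 h2, f2]
              simp
            · rw [h2, An, Stmt14Aux.suf_n _ _ le_rfl]
          rw [S _ (by omega) (by omega), S _ (by omega) (by omega)] at g
          simp only [ha]
          rw [if_neg (fun h => h0 h.2), g]
          simp
      · have S : ∀ k, k ≤ n → Stmt14Aux.suf (za τ) k = A τ k := by
          intro k h2
          rcases h2.lt_or_eq with h2 | h2
          · rw [Alt _ _ h2, c1 ⟨τ, h⟩, e5 ⟨τ, h⟩ k h2, f3]
            simp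
          · rw [h2, An, Stmt14Aux.suf_n _ _ le_rfl]
        rw [S _ (by omega), S _ (by omega)] at g
        simp only [ha]
        rw [if_neg (fun h' => h h'.1), g]
        simp
    rw [e0, f1, f2, f3, f4]
end
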